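/- Let G be a finite simple claw-free minimal 2-extendable graph with δ(G) ≥ 6. Then every vertex u of G is incident with at most two edges of type 2. -/

import Mathlib

open SimpleGraph

/-- A graph `G` is `k`-extendable if it is connected, has a perfect matching, and every
matching of size `k` is contained in a perfect matching. -/
def KExt {V : Type*} [Fintype V] (G : SimpleGraph V) (k : ℕ) : Prop :=
  G.Connected ∧ (∃ P : G.Subgraph, P.IsPerfectMatching) ∧
    ∀ M : G.Subgraph, M.IsMatching → M.edgeSet.ncard = k →
      ∃ P : G.Subgraph, P.IsPerfectMatching ∧ M ≤ P

/-- A `k`-extendable graph is minimal if deleting any edge destroys `k`-extendability. -/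
def MinimalKExt {V : Type*} [Fintype V] (G : SimpleGraph V) (k : ℕ) : Prop :=
  KExt G k ∧ ∀ e ∈ G.edgeSet, ¬ KExt (G.deleteEdges {e}) k

/-- A graph is claw-free if it has no induced subgraph isomorphic to `K_{1,3}`. -/
def ClawFree {V : Type*} (G : SimpleGraph V) : Prop :=
  ∀ u a b c : V, G.Adj u a → G.Adj u b → G.Adj u c →
    a ≠ b → a ≠ c → b ≠ c → ¬G.Adj a b → ¬G.Adj a c → ¬G.Adj b c → False

/-- The graph `G - e - S` obtained from `G` by deleting the edge `e = uv` and the vertices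
of `S`. -/
def Ge {V : Type*} (G : SimpleGraph V) (u v : V) (S : Set V) : SimpleGraph ↑(Sᶜ) :=
  (G.deleteEdges {s(u, v)}).induce Sᶜ

/-- `S` is an admissible set for the edge `uv` (with parameter `k`): `S ⊆ V ∖ {u, v}`,
`G[S]` has a matching of size at least `k`, the number of odd components of `G - uv - S`
equals `|S| - 2k + 2`, and `u`, `v` lie in two distinct odd components of `G - uv - S`. -/
def Admissible {V : Type*} [Fintype V] (G : SimpleGraph V) (k : ℕ) (u v : V) (S : Set V) :
    Prop :=
  u ∉ S ∧ v ∉ S ∧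
  (∃ M : G.Subgraph, M.IsMatching ∧ M.verts ⊆ S ∧ k ≤ M.edgeSet.ncard) ∧
  Set.ncard {C : (Ge G u v S).ConnectedComponent | Odd C.supp.ncard} + 2 * k = S.ncard + 2 ∧
  ∃ (hu : u ∈ Sᶜ) (hv : v ∈ Sᶜ),
    (Ge G u v S).connectedComponentMk ⟨u, hu⟩ ≠ (Ge G u v S).connectedComponentMk ⟨v, hv⟩ ∧
    Odd ((Ge G u v S).connectedComponentMk ⟨u, hu⟩).supp.ncard ∧
    Odd ((Ge G u v S).connectedComponentMk ⟨v, hv⟩).supp.ncard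

/-- The edge `uv` has type `m` (`m = 4`: type 1, `m = 5`: type 2) if the minimum cardinality
of an admissible set for `uv` is `m`. -/
def EdgeType {V : Type*} [Fintype V] (G : SimpleGraph V) (u v : V) (m : ℕ) : Prop :=
  (∃ S : Set V, Admissible G 2 u v S ∧ S.ncard = m) ∧
  ∀ S : Set V, Admissible G 2 u v S → m ≤ S.ncard

lemma even_ncard_of_stable {α : Type*} [Finite α] {m : α → α} (hm : ∀ x, m (m x) = x)
    (hne : ∀ x, m x ≠ x) {Z : Set α} (hZ : ∀ x ∈ Z, m x ∈ Z) : Even Z.ncard := by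
  classical
  have := Fintype.ofFinite α
  rw [Set.ncard_eq_toFinset_card' Z]
  have h : ∑ _x ∈ Z.toFinset, (1 : ZMod 2) = 0 :=
    Finset.sum_involution (fun a _ => m a) (fun a _ => by decide) (fun a _ _ => hne a)
      (fun a ha => by simpa using hZ a (by simpa using ha)) (fun a _ => hm a)
  rw [Finset.sum_const, nsmul_eq_mul, mul_one] at h
  exact (ZMod.natCast_eq_zero_iff_even).1 h

lemma ncard_sdiff_singleton_parity {α : Type*} [Finite α] {Z : Set α} {x : α} (hx : x ∈ Z)
    (h : Even (Z \ {x}).ncard) : Odd Z.ncard := by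
  rw [← Set.ncard_sdiff_singleton_add_one hx]
  exact h.add_one

/-- `m` sends each vertex to its partner in a perfect matching of `G`. -/
def IsMate {V : Type*} (G : SimpleGraph V) (m : V → V) : Prop :=
  (∀ x, G.Adj x (m x)) ∧ ∀ x, m (m x) = x

lemma IsMate.even {V : Type*} [Finite V] {G : SimpleGraph V} {m : V → V} (hm : IsMate G m)
    {Z : Set V} (hZ : ∀ x ∈ Z, m x ∈ Z) : Even Z.ncard :=
  even_ncard_of_stable hm.2 (fun x => (hm.1 x).ne') hZ

lemma IsMate.odd {V : Type*} [Finite V] {G : SimpleGraph V} {m : V → V} (hm : IsMate G m)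
    {Z : Set V} {x : V} (hx : x ∈ Z) (hZ : ∀ y ∈ Z, y ≠ x → m y ∈ Z ∧ m y ≠ x) :
    Odd Z.ncard :=
  ncard_sdiff_singleton_parity hx (hm.even fun y hy => by
    simpa using hZ y hy.1 (by simpa using hy.2))

lemma exists_pair_matching {V : Type*} {G : SimpleGraph V} {a b c d : V}
    (hnd : [a, b, c, d].Nodup) (hab : G.Adj a b) (hcd : G.Adj c d) :
    ∃ M : G.Subgraph, M.IsMatching ∧ M.verts = {a, b, c, d} ∧ M.edgeSet.ncard = 2 ∧
      M.Adj a b ∧ M.Adj c d := by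
  refine ⟨G.subgraphOfAdj hab ⊔ G.subgraphOfAdj hcd, ?_, ?_, ?_, ?_, ?_⟩
  · refine (Subgraph.IsMatching.subgraphOfAdj hab).sup (Subgraph.IsMatching.subgraphOfAdj hcd) ?_
    rw [(Subgraph.IsMatching.subgraphOfAdj hab).support_eq_verts,
      (Subgraph.IsMatching.subgraphOfAdj hcd).support_eq_verts, Set.disjoint_left]
    simp at hnd ⊢
    grind
  · ext x; simp; tauto
  · rw [Subgraph.edgeSet_sup, edgeSet_subgraphOfAdj, edgeSet_subgraphOfAdj,
      Set.singleton_union, Set.ncard_pair]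
    simp at hnd ⊢
    grind
  · simp
  · simp

lemma KExt.exists_mate {V : Type*} [Fintype V] {G : SimpleGraph V} (hG : KExt G 2)
    {a b c d : V} (hnd : [a, b, c, d].Nodup) (hab : G.Adj a b) (hcd : G.Adj c d) :
    ∃ m, IsMate G m ∧ m a = b ∧ m b = a ∧ m c = d ∧ m d = c := by
  obtain ⟨M, hM, -, hcard, h1, h2⟩ := exists_pair_matching hnd hab hcd
  obtain ⟨P, hP, hle⟩ := hG.2.2 M hM hcard
  choose m hm hu using Subgraph.isPerfectMatching_iff.1 hP
  have key : ∀ x y, P.Adj x y → m x = y := fun x y h => (hu x y h).symm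
  exact ⟨m, ⟨fun x => (hm x).adj_sub, fun x => key _ _ (hm x).symm⟩, key _ _ (hle.2 h1),
    key _ _ (hle.2 h1.symm), key _ _ (hle.2 h2), key _ _ (hle.2 h2.symm)⟩

/-- In a connected graph no proper nonempty vertex set is closed under adjacency. -/
lemma SimpleGraph.Connected.eq_univ_of_closed {V : Type*} {G : SimpleGraph V}
    (hG : G.Connected) {X : Set V} (hX : X.Nonempty) (h : ∀ x ∈ X, ∀ y, G.Adj x y → y ∈ X)
    (y : V) : y ∈ X := by
  obtain ⟨x, hx⟩ := hX
  obtain ⟨p⟩ := hG.preconnected x y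
  induction p with
  | nil => exact hx
  | cons hxy _ ih => exact ih (h _ hx _ hxy)

/-- Every vertex has degree at least six. -/
def SixNbrs {V : Type*} (G : SimpleGraph V) : Prop :=
  ∀ (x : V) (l : List V), l.length ≤ 5 → ∃ y, G.Adj x y ∧ y ∉ l

lemma sixNbrs_of_minDegree {V : Type*} [Fintype V] {G : SimpleGraph V} [DecidableRel G.Adj]
    (h : 6 ≤ G.minDegree) : SixNbrs G := by
  classical
  intro x l hl
  by_contra! hc
  have h1 : G.neighborFinset x ⊆ l.toFinset := fun y hy => by
    simpa using hc y (by simpa using hy)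
  have h2 := Finset.card_le_card h1
  have h3 := l.toFinset_card_le
  have h4 := G.minDegree_le_degree x
  rw [G.card_neighborFinset_eq_degree] at h2
  omega

lemma KExt.false_of_two_cut_aux {V : Type*} [Fintype V] {G : SimpleGraph V} (hG : KExt G 2)
    (hd : SixNbrs G) {a b : V} (hab : a ≠ b) {X Y : Set V} (ha : a ∉ X) (hb : b ∉ X)
    (ha' : a ∉ Y) (hb' : b ∉ Y) (hXY : Disjoint X Y)
    (hcov : ∀ z, z ∈ X ∨ z ∈ Y ∨ z = a ∨ z = b) (hsep : ∀ x ∈ X, ∀ y ∈ Y, ¬ G.Adj x y)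
    (hX : X.Nonempty) (hY : Y.Nonempty)
    (h2 : ∃ x ∈ X, ∃ x' ∈ X, x ≠ x' ∧ G.Adj a x ∧ G.Adj a x') : False := by
  rw [Set.disjoint_left] at hXY
  have hdiff : ∀ {x y : V}, x ∈ X → y ∈ Y → x ≠ y := by grind
  have symm : ∀ {x y : V}, G.Adj x y → G.Adj y x := fun h => h.symm
  have cross : ∀ p q, ({p, q} : Set V) = {a, b} → p ≠ q → ∀ x ∈ X, ∀ y ∈ Y, G.Adj p x →
      G.Adj q y → Odd X.ncard := by
    intro p q hpq hne x hx y hy hpx hqy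
    have hp : p = a ∨ p = b := by
      have : p ∈ ({p, q} : Set V) := by simp
      simpa [hpq] using this
    have hq : q = a ∨ q = b := by
      have : q ∈ ({p, q} : Set V) := by simp
      simpa [hpq] using this
    obtain ⟨m, hm, h1, h2, h3, h4⟩ := hG.exists_mate (a := p) (b := x) (c := q) (d := y)
      (by simp; grind) hpx hqy
    refine hm.odd hx fun z hz hzx => ?_
    have := hm.1 z
    have := hm.2 z
    have := hcov (m z)
    grind
  have same : ∀ Z : Set V, (Z = X ∨ Z = Y) → ∀ x ∈ Z, ∀ x' ∈ Z, x ≠ x' → G.Adj a x →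
      G.Adj b x' → Even X.ncard := by
    intro Z hZ x hx x' hx' hne hax hbx
    obtain ⟨m, hm, h1, h2, h3, h4⟩ := hG.exists_mate (a := a) (b := x) (c := b) (d := x')
      (by simp; grind) hax hbx
    rcases hZ with rfl | rfl
    · have h5 := hm.even (Z := Z ∪ {a, b}) fun z hz => by
        have := hm.1 z
        have := hm.2 z
        have := hcov (m z)
        simp at hz ⊢
        grind
      rw [Set.ncard_union_eq (by simp [ha, hb]), Set.ncard_pair hab] at h5
      grind
    · refine hm.even fun z hz => ?_
      have := hm.1 z
      have := hm.2 z
      have := hcov (m z)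
      grind
  have conX : (∃ x ∈ Y, G.Adj a x) ∨ ∃ x ∈ Y, G.Adj b x := by
    by_contra! hc
    obtain ⟨x, hx⟩ := hX
    have := hG.1.eq_univ_of_closed hY (fun y hy z hz => by
      have := hcov z
      have := symm hz
      grind) x
    exact hXY hx this
  have nOE : Odd X.ncard → Even X.ncard → False := fun h h' => by grind
  obtain ⟨x, hx, x', hx', hxx, hax, hax'⟩ := h2
  by_cases hadj : G.Adj a b
  · have hev : Even X.ncard := by
      obtain ⟨w, hxw, hw⟩ := hd x [a, b] (by simp)
      have hwX : w ∈ X := by simp at hw; have := hcov w; grind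
      obtain ⟨m, hm, h1, h2, h3, h4⟩ := hG.exists_mate (a := a) (b := b) (c := x) (d := w)
        (by have := hxw.ne; simp; grind) hadj hxw
      refine hm.even fun z hz => ?_
      have := hm.1 z
      have := hm.2 z
      have := hcov (m z)
      grind
    have hbY : ∀ y ∈ Y, ¬ G.Adj b y := fun y hy h => nOE (cross a b rfl hab x hx y hy hax h) hev
    obtain ⟨y, hy, hay⟩ : ∃ y ∈ Y, G.Adj a y := by grind
    obtain ⟨w, hbw, hw⟩ := hd b [a] (by simp)
    have hwX : w ∈ X := by
      simp at hw; have := hcov w; have := hbw.ne; grind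
    exact nOE (cross b a (Set.pair_comm b a) hab.symm w hwX y hy hbw hay) hev
  by_cases hbX : ∃ z ∈ X, G.Adj b z
  · obtain ⟨z, hz, hbz⟩ := hbX
    have hev : Even X.ncard := by
      by_cases hzx : z = x
      · exact same X (.inl rfl) x' hx' z hz (by grind) hax' hbz
      · exact same X (.inl rfl) x hx z hz (by grind) hax hbz
    rcases conX with ⟨y, hy, h⟩ | ⟨y, hy, h⟩
    · exact nOE (cross b a (Set.pair_comm b a) hab.symm z hz y hy hbz h) hev
    · exact nOE (cross a b rfl hab x hx y hy hax h) hev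
  · push Not at hbX
    obtain ⟨y, hby, hy⟩ := hd b [a] (by simp)
    obtain ⟨y', hby', hy'⟩ := hd b [a, y] (by simp)
    simp at hy hy'
    have hyY : y ∈ Y := by have := hcov y; have := hby.ne; grind
    have hyY' : y' ∈ Y := by have := hcov y'; have := hby'.ne; grind
    have hodd := cross a b rfl hab x hx y hyY hax hby
    have haY : ∀ z ∈ Y, ¬ G.Adj a z := by
      intro z hz haz
      by_cases hzy : z = y
      · exact nOE hodd (same Y (.inr rfl) z hz y' hyY' (by grind) haz hby')
      · exact nOE hodd (same Y (.inr rfl) z hz y hyY hzy haz hby)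
    have := hG.1.eq_univ_of_closed (X := insert a X) ⟨a, by simp⟩ (fun p hp q hpq => by
      have := hcov q
      have := symm hpq
      simp at hp ⊢
      grind) y
    simp at this
    grind

lemma KExt.false_of_two_cut {V : Type*} [Fintype V] {G : SimpleGraph V} (hG : KExt G 2)
    (hd : SixNbrs G) {a b : V} (hab : a ≠ b) {X : Set V} (ha : a ∉ X) (hb : b ∉ X)
    (hX : X.Nonempty) (hcl : ∀ x ∈ X, ∀ y, G.Adj x y → y ∈ X ∨ y = a ∨ y = b)
    {y : V} (hy : y ∉ X) (hya : y ≠ a) (hyb : y ≠ b) : False := by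
  set Y : Set V := {z | z ∉ X ∧ z ≠ a ∧ z ≠ b} with hYdef
  have hYmem : ∀ z, z ∈ Y ↔ z ∉ X ∧ z ≠ a ∧ z ≠ b := fun z => Iff.rfl
  have hcov : ∀ z, z ∈ X ∨ z ∈ Y ∨ z = a ∨ z = b := by grind
  have hsep : ∀ x ∈ X, ∀ y ∈ Y, ¬ G.Adj x y := by grind
  have hXY : Disjoint X Y := by rw [Set.disjoint_left]; grind
  have hY : Y.Nonempty := ⟨y, hy, hya, hyb⟩
  by_cases h2 : ∃ x ∈ X, ∃ x' ∈ X, x ≠ x' ∧ G.Adj a x ∧ G.Adj a x'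
  · exact hG.false_of_two_cut_aux hd hab ha hb (by grind) (by grind) hXY hcov hsep hX hY h2
  refine hG.false_of_two_cut_aux hd hab (X := Y) (Y := X) (by grind) (by grind) ha hb hXY.symm
    (by grind) (fun x hx y hy h => hsep y hy x hx h.symm) hY hX ?_
  by_cases h1 : ∃ x ∈ X, G.Adj a x
  · obtain ⟨x, hx, hax⟩ := h1
    obtain ⟨p, hap, hp⟩ := hd a [x, b] (by simp)
    obtain ⟨q, haq, hq⟩ := hd a [x, b, p] (by simp)
    simp at hp hq
    have := hap.ne
    have := haq.ne
    exact ⟨p, by grind, q, by grind, by grind, hap, haq⟩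
  · obtain ⟨p, hap, hp⟩ := hd a [b] (by simp)
    obtain ⟨q, haq, hq⟩ := hd a [b, p] (by simp)
    simp at hp hq
    have := hap.ne
    have := haq.ne
    exact ⟨p, by grind, q, by grind, by grind, hap, haq⟩

lemma KExt.false_of_three_cut {V : Type*} [Fintype V] {G : SimpleGraph V} (hG : KExt G 2)
    (hd : SixNbrs G) {a b c : V} (hab : G.Adj a b) (hca : c ≠ a) (hcb : c ≠ b) {X : Set V}
    (ha : a ∉ X) (hb : b ∉ X) (hc : c ∉ X) (hX : X.Nonempty)
    (hcl : ∀ x ∈ X, ∀ y, G.Adj x y → y ∈ X ∨ y = a ∨ y = b ∨ y = c)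
    {y : V} (hy : y ∉ X) (hya : y ≠ a) (hyb : y ≠ b) (hyc : y ≠ c) : False := by
  have symm : ∀ {x y : V}, G.Adj x y → G.Adj y x := fun h => h.symm
  by_cases h1 : ∃ x ∈ X, G.Adj c x
  · by_cases h2 : ∃ z, z ∉ X ∧ z ≠ a ∧ z ≠ b ∧ z ≠ c ∧ G.Adj c z
    · obtain ⟨x, hx, hcx⟩ := h1
      obtain ⟨z, hz, hza, hzb, hzc, hcz⟩ := h2
      have hodd : Odd X.ncard := by
        obtain ⟨m, hm, h1, h2, h3, h4⟩ := hG.exists_mate (a := a) (b := b) (c := c) (d := x)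
          (by have := hab.ne; simp; grind) hab hcx
        refine hm.odd hx fun w hw hwx => ?_
        have := hm.1 w
        have := hm.2 w
        have := hcl w hw (m w)
        grind
      have heven : Even X.ncard := by
        obtain ⟨m, hm, h1, h2, h3, h4⟩ := hG.exists_mate (a := a) (b := b) (c := c) (d := z)
          (by have := hab.ne; simp; grind) hab hcz
        refine hm.even fun w hw => ?_
        have := hm.1 w
        have := hm.2 w
        have := hcl w hw (m w)
        grind
      grind
    · refine hG.false_of_two_cut hd hab.ne (X := insert c X) (by grind) (by grind) ⟨c, by simp⟩
        (fun p hp q hpq => ?_) (y := y) (by grind) hya hyb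
      simp at hp ⊢
      grind
  · refine hG.false_of_two_cut hd hab.ne ha hb hX (fun p hp q hpq => ?_) (y := c) hc hca hcb
    have := symm hpq
    have := hcl p hp q hpq
    grind

lemma Ge_adj {V : Type*} {G : SimpleGraph V} {u v : V} {S : Set V} {x y : ↥(Sᶜ)} :
    (Ge G u v S).Adj x y ↔ G.Adj x y ∧ s((x : V), (y : V)) ≠ s(u, v) := by
  simp [Ge]

/-- A four-vertex set covered by a 2-matching is admissible for `uv` as soon as deleting it and
the edge `uv` leaves an odd closed set of vertices that separates `u` from `v`. -/
lemma KExt.admissible_of_odd_closed {V : Type*} [Fintype V] {G : SimpleGraph V}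
    (hG : KExt G 2) {u v a b c d : V} (hnd : [a, b, c, d].Nodup) (hab : G.Adj a b)
    (hcd : G.Adj c d) (hu : u ∉ ({a, b, c, d} : Set V)) (hv : v ∉ ({a, b, c, d} : Set V))
    {X : Set V} (huX : u ∈ X) (hvX : v ∉ X) (hXS : ∀ x ∈ X, x ∉ ({a, b, c, d} : Set V))
    (hodd : Odd X.ncard)
    (hcl : ∀ x ∈ X, ∀ y, G.Adj x y → y ∈ X ∨ y ∈ ({a, b, c, d} : Set V) ∨ x = u ∧ y = v) :
    Admissible G 2 u v {a, b, c, d} := by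
  obtain ⟨m, hm, h1, h2, h3, h4⟩ := hG.exists_mate hnd hab hcd
  obtain ⟨M, hM, hMv, hMc, -, -⟩ := exists_pair_matching hnd hab hcd
  set S : Set V := {a, b, c, d} with hS
  have hScard : S.ncard = 4 := by
    simp at hnd
    rw [hS, Set.ncard_insert_of_notMem (by simp; grind), Set.ncard_insert_of_notMem (by simp; grind),
      Set.ncard_pair (by grind)]
  have hmS : ∀ x ∈ S, m x ∈ S := by
    intro x hx
    simp only [hS, Set.mem_insert_iff, Set.mem_singleton_iff] at hx ⊢
    grind
  have hmS' : ∀ x, x ∉ S → m x ∉ S := fun x hx h => hx (hm.2 x ▸ hmS _ h)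
  have huv : m u = v := by
    by_contra hne
    have : Even X.ncard := hm.even fun x hx => by
      rcases hcl x hx _ (hm.1 x) with h | h | ⟨rfl, h⟩
      · exact h
      · exact absurd h (hmS' x (hXS x hx))
      · exact absurd h hne
    grind
  have hvu : m v = u := huv ▸ hm.2 u
  set H := Ge G u v S with hH
  let m' : ↥(Sᶜ) → ↥(Sᶜ) := fun x => ⟨m x, hmS' x x.2⟩
  have hm' : ∀ x, m' (m' x) = x := fun x => Subtype.ext (hm.2 x)
  have hne' : ∀ x, m' x ≠ x := fun x h => (hm.1 x).ne' (congrArg Subtype.val h)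
  let u' : ↥(Sᶜ) := ⟨u, hu⟩
  let v' : ↥(Sᶜ) := ⟨v, hv⟩
  have hmu : m' u' = v' := Subtype.ext huv
  have hmv : m' v' = u' := Subtype.ext hvu
  have hst : ∀ (K : H.ConnectedComponent), ∀ x ∈ K.supp, x ≠ u' → x ≠ v' → m' x ∈ K.supp := by
    intro K x hx hxu hxv
    rw [ConnectedComponent.mem_supp_iff] at hx ⊢
    rw [← hx, ConnectedComponent.eq]
    have : H.Adj x (m' x) := by
      refine Ge_adj.2 ⟨hm.1 x, fun h => ?_⟩
      have h' : (x : V) ≠ u := fun h => hxu (Subtype.ext h)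
      have h'' : (x : V) ≠ v := fun h => hxv (Subtype.ext h)
      rw [Sym2.eq_iff] at h
      grind
    exact this.symm.reachable
  have hsep : ∀ x : ↥(Sᶜ), H.Reachable u' x → (x : V) ∈ X := by
    rintro x ⟨p⟩
    have aux : ∀ {x y : ↥(Sᶜ)} (p : H.Walk x y), (x : V) ∈ X → (y : V) ∈ X := by
      intro x y p
      induction p with
      | nil => exact id
      | @cons x y z hxy _ ih =>
        intro hx
        obtain ⟨hxy, hne⟩ := Ge_adj.1 hxy
        rcases hcl _ hx _ hxy with h | h | ⟨h, h'⟩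
        · exact ih h
        · exact absurd h y.2
        · rw [h, h'] at hne; exact absurd rfl hne
    exact aux p huX
  have hCne : H.connectedComponentMk u' ≠ H.connectedComponentMk v' := fun h =>
    hvX (hsep v' (ConnectedComponent.eq.1 h))
  have hCu : Odd (H.connectedComponentMk u').supp.ncard := by
    refine ncard_sdiff_singleton_parity (x := u') rfl
      (even_ncard_of_stable hm' hne' fun x hx => ?_)
    have hxu : x ≠ u' := hx.2
    have hxv : x ≠ v' := by
      rintro rfl
      exact hCne hx.1.symm
    refine ⟨hst _ x hx.1 hxu hxv, fun h => hxv ?_⟩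
    rw [← hm' x, show m' x = u' from h, hmu]
  have hCv : Odd (H.connectedComponentMk v').supp.ncard := by
    refine ncard_sdiff_singleton_parity (x := v') rfl
      (even_ncard_of_stable hm' hne' fun x hx => ?_)
    have hxv : x ≠ v' := hx.2
    have hxu : x ≠ u' := by
      rintro rfl
      exact hCne hx.1
    refine ⟨hst _ x hx.1 hxu hxv, fun h => hxu ?_⟩
    rw [← hm' x, show m' x = v' from h, hmv]
  have hset : {K : H.ConnectedComponent | Odd K.supp.ncard} =
      {H.connectedComponentMk u', H.connectedComponentMk v'} := by
    ext K
    simp only [Set.mem_ofPred_eq, Set.mem_insert_iff, Set.mem_singleton_iff]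
    refine ⟨fun hK => ?_, by rintro (rfl | rfl) <;> assumption⟩
    by_contra! hc
    have : Even K.supp.ncard := even_ncard_of_stable hm' hne' fun x hx =>
      hst K x hx (by rintro rfl; exact hc.1 hx.symm) (by rintro rfl; exact hc.2 hx.symm)
    grind
  refine ⟨hu, hv, ⟨M, hM, hMv.le, hMc.ge⟩, ?_, hu, hv, hCne, hCu, hCv⟩
  rw [show Ge G u v S = H from rfl, hset, Set.ncard_pair hCne, hScard]

/-- The vertex sets around an edge `uv` of type 2: a five-vertex admissible set `S` and three odd
components `A ∋ u`, `B ∋ v` and `W` of the graph without `S` and `uv`. -/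
structure TypeTwoCut {V : Type*} [Fintype V] (G : SimpleGraph V) (u v : V)
    (S A B W : Set V) : Prop where
  adj : G.Adj u v
  le_ncard : ∀ T : Set V, Admissible G 2 u v T → 5 ≤ T.ncard
  matching : ∃ a b c d f, S = {a, b, c, d, f} ∧ [a, b, c, d, f].Nodup ∧ G.Adj a b ∧ G.Adj c d
  mem_left : u ∈ A
  mem_right : v ∈ B
  odd_left : Odd A.ncard
  odd_right : Odd B.ncard
  odd_third : Odd W.ncard
  disj : ∀ x, (x ∈ A → x ∉ B ∧ x ∉ W ∧ x ∉ S) ∧ (x ∈ B → x ∉ W ∧ x ∉ S) ∧ (x ∈ W → x ∉ S)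
  closed_left : ∀ x ∈ A, ∀ y, G.Adj x y → y ∈ A ∨ y ∈ S ∨ x = u ∧ y = v
  closed_right : ∀ x ∈ B, ∀ y, G.Adj x y → y ∈ B ∨ y ∈ S ∨ x = v ∧ y = u
  closed_third : ∀ x ∈ W, ∀ y, G.Adj x y → y ∈ W ∨ y ∈ S
  conn_left : ∀ T ⊆ A, T.Nonempty → (∀ x ∈ T, ∀ y ∈ A, G.Adj x y → y ∈ T) → T = A
  conn_third : ∀ T ⊆ W, T.Nonempty → (∀ x ∈ T, ∀ y ∈ W, G.Adj x y → y ∈ T) → T = W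

/-- The vertices of a component of `G - uv - S`, as a set of vertices of `G`. -/
def compSet {V : Type*} {G : SimpleGraph V} {u v : V} {S : Set V}
    (K : (Ge G u v S).ConnectedComponent) : Set V :=
  Subtype.val '' K.supp

section compSet

variable {V : Type*} {G : SimpleGraph V} {u v : V} {S : Set V}
  {K L : (Ge G u v S).ConnectedComponent}

lemma notMem_of_mem_compSet {x : V} (hx : x ∈ compSet K) : x ∉ S := by
  obtain ⟨x, -, rfl⟩ := hx
  exact x.2

lemma ncard_compSet : (compSet K).ncard = K.supp.ncard :=
  Set.ncard_image_of_injective _ Subtype.val_injective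

lemma compSet_disjoint (h : K ≠ L) {x : V} (hx : x ∈ compSet K) : x ∉ compSet L := by
  rintro ⟨y, hy, rfl⟩
  obtain ⟨x, hx, hxy⟩ := hx
  obtain rfl := Subtype.ext hxy
  exact h (hx.symm.trans hy)

lemma compSet_closed {x y : V} (hx : x ∈ compSet K) (hxy : G.Adj x y) (hne : s(x, y) ≠ s(u, v)) :
    y ∈ compSet K ∨ y ∈ S := by
  by_cases hy : y ∈ S
  · exact .inr hy
  obtain ⟨x, hx, rfl⟩ := hx
  have h : (Ge G u v S).Adj x ⟨y, hy⟩ := Ge_adj.2 ⟨hxy, hne⟩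
  exact .inl ⟨⟨y, hy⟩, (ConnectedComponent.eq.2 h.symm.reachable).trans hx, rfl⟩

lemma compSet_conn {T : Set V} (hT : T ⊆ compSet K) (hne : T.Nonempty)
    (h : ∀ x ∈ T, ∀ y ∈ compSet K, G.Adj x y → y ∈ T) : T = compSet K := by
  refine hT.antisymm ?_
  rintro _ ⟨y, hy, rfl⟩
  obtain ⟨x, hx⟩ := hne
  obtain ⟨x, hxK, rfl⟩ := hT hx
  obtain ⟨p⟩ := ConnectedComponent.eq.1 (hxK.trans hy.symm)
  have aux : ∀ {x y : ↥(Sᶜ)} (p : (Ge G u v S).Walk x y), (x : V) ∈ T → (y : V) ∈ T := by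
    intro x y p
    induction p with
    | nil => exact id
    | @cons x y z hxy _ ih =>
      intro hx
      obtain ⟨x', hx', hxx⟩ := hT hx
      obtain rfl := Subtype.ext hxx
      exact ih (h _ hx _ ⟨y, (ConnectedComponent.eq.2 hxy.symm.reachable).trans hx', rfl⟩
        (Ge_adj.1 hxy).1)
  exact aux p hx

end compSet

lemma exists_pairs_of_matching {V : Type*} [Finite V] {G : SimpleGraph V} {S : Set V}
    (hS : S.ncard = 5) {M : G.Subgraph} (hM : M.IsMatching) (hMS : M.verts ⊆ S)
    (hc : 2 ≤ M.edgeSet.ncard) :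
    ∃ a b c d f, S = {a, b, c, d, f} ∧ [a, b, c, d, f].Nodup ∧ G.Adj a b ∧ G.Adj c d := by
  obtain ⟨e, e', he, he', hne⟩ := (Set.one_lt_ncard_iff).1 hc
  induction e using Sym2.ind with | _ a b
  induction e' using Sym2.ind with | _ c d
  rw [Subgraph.mem_edgeSet] at he he'
  have hnd : [a, b, c, d].Nodup := by
    have h1 := he.ne
    have h2 := he'.ne
    have key : ∀ {x y z}, M.Adj x y → M.Adj x z → y = z := fun h h' => hM.eq_of_adj_left h h'
    have hs := he.symm
    have hs' := he'.symm
    simp at hne ⊢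
    grind
  have hsub : ({a, b, c, d} : Set V) ⊆ S := by
    intro x hx
    apply hMS
    simp at hx
    rcases hx with rfl | rfl | rfl | rfl
    exacts [he.fst_mem, he.snd_mem, he'.fst_mem, he'.snd_mem]
  have hcard : ({a, b, c, d} : Set V).ncard = 4 := by
    simp at hnd
    rw [Set.ncard_insert_of_notMem (by simp; grind), Set.ncard_insert_of_notMem (by simp; grind),
      Set.ncard_pair (by grind)]
  obtain ⟨f, hf⟩ := Set.ncard_eq_one.1
    (show (S \ {a, b, c, d}).ncard = 1 by rw [Set.ncard_sdiff hsub, hS, hcard])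
  have hfS : f ∈ S \ {a, b, c, d} := hf ▸ rfl
  have hSeq : S = {a, b, c, d, f} := by
    ext x
    have hx : x ∈ S \ {a, b, c, d} ↔ x = f := by rw [hf]; rfl
    have hx' := @hsub x
    have := hfS.1
    simp at hx hx' ⊢
    grind
  refine ⟨a, b, c, d, f, hSeq, ?_, he.adj_sub, he'.adj_sub⟩
  have := hfS.2
  simp at hnd this ⊢
  grind

lemma EdgeType.exists_cut {V : Type*} [Fintype V] {G : SimpleGraph V} {u v : V}
    (huv : G.Adj u v) (h : EdgeType G u v 5) : ∃ S A B W, TypeTwoCut G u v S A B W := by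
  obtain ⟨⟨S, ⟨hu, hv, ⟨M, hM, hMS, hMc⟩, hodd, hu', hv', hne, ho, ho'⟩, hS⟩, hmin⟩ := h
  set K := (Ge G u v S).connectedComponentMk ⟨u, hu'⟩
  set L := (Ge G u v S).connectedComponentMk ⟨v, hv'⟩
  obtain ⟨Q, hQ, hQKL⟩ : ∃ Q ∈ {C : (Ge G u v S).ConnectedComponent | Odd C.supp.ncard},
      Q ∉ ({K, L} : Set _) := Set.exists_mem_notMem_of_ncard_lt_ncard (by
    have := Set.ncard_pair hne
    omega)
  have hQK : K ≠ Q := fun h => hQKL (by simp [h])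
  have hQL : L ≠ Q := fun h => hQKL (by simp [h])
  have huK : u ∈ compSet K := ⟨⟨u, hu'⟩, rfl, rfl⟩
  have hvL : v ∈ compSet L := ⟨⟨v, hv'⟩, rfl, rfl⟩
  refine ⟨S, compSet K, compSet L, compSet Q, huv, hmin, exists_pairs_of_matching hS hM hMS hMc,
    huK, hvL, by rwa [ncard_compSet], by rwa [ncard_compSet], by rw [ncard_compSet]; exact hQ,
    fun x => ⟨fun hx => ⟨compSet_disjoint hne hx, compSet_disjoint hQK hx,
      notMem_of_mem_compSet hx⟩, fun hx => ⟨compSet_disjoint hQL hx, notMem_of_mem_compSet hx⟩,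
      notMem_of_mem_compSet⟩, ?_, ?_, ?_, fun T => compSet_conn, fun T => compSet_conn⟩
  · intro x hx y hxy
    by_cases h : s(x, y) = s(u, v)
    · rw [Sym2.eq_iff] at h
      have := compSet_disjoint hne hx
      grind
    · have := compSet_closed hx hxy h
      tauto
  · intro x hx y hxy
    by_cases h : s(x, y) = s(u, v)
    · rw [Sym2.eq_iff] at h
      have := compSet_disjoint hne.symm hx
      grind
    · have := compSet_closed hx hxy h
      tauto
  · intro x hx y hxy
    refine compSet_closed hx hxy fun h => ?_
    have h1 := compSet_disjoint hQK.symm hx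
    have h2 := compSet_disjoint hQL.symm hx
    rw [Sym2.eq_iff] at h
    grind

/-- The vertex `f` of `S` sees all three odd components, the first two only in `u` and `v`, and
nothing else outside `S`. -/
structure IsFull {V : Type*} (G : SimpleGraph V) (u v : V) (S A B W : Set V) (f : V) : Prop where
  adj_left : G.Adj f u
  adj_right : G.Adj f v
  adj_third : ∃ w ∈ W, G.Adj f w
  eq_left : ∀ x ∈ A, G.Adj f x → x = u
  eq_right : ∀ x ∈ B, G.Adj f x → x = v
  nbr : ∀ z, G.Adj f z → z ∈ S ∨ z = u ∨ z = v ∨ z ∈ W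

namespace TypeTwoCut

variable {V : Type*} [Fintype V] {G : SimpleGraph V} {u v : V} {S A B W : Set V}

lemma exists_mate (h : TypeTwoCut G u v S A B W) (hG : KExt G 2) {a b c d f : V}
    (hS : ∀ x, x ∈ S ↔ x = a ∨ x = b ∨ x = c ∨ x = d ∨ x = f) (hnd : [a, b, c, d, f].Nodup)
    (hab : G.Adj a b) (hcd : G.Adj c d) :
    ∃ m, IsMate G m ∧ m f ∈ W ∧ ∀ x ∈ S, x ≠ f → m x ∈ S := by
  obtain ⟨m, hm, h1, h2, h3, h4⟩ := hG.exists_mate (a := a) (b := b) (c := c) (d := d)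
    (by simp at hnd ⊢; grind) hab hcd
  have hmS : ∀ x ∈ S, x ≠ f → m x ∈ S := by grind
  refine ⟨m, hm, ?_, hmS⟩
  obtain ⟨w, hw, hmw⟩ : ∃ w ∈ W, m w ∉ W := by
    by_contra! hc
    exact Nat.not_even_iff_odd.2 h.odd_third (hm.even hc)
  have h5 := (h.closed_third w hw _ (hm.1 w)).resolve_left hmw
  by_cases h6 : m w = f
  · rwa [← h6, hm.2]
  · have := hmS _ h5 h6
    rw [hm.2] at this
    exact absurd this ((h.disj w).2.2 hw)

lemma even_of_closed (h : TypeTwoCut G u v S A B W) (hG : KExt G 2) {Z : Set V}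
    (hZS : ∀ x ∈ Z, x ∉ S ∧ x ∉ W) (hcl : ∀ x ∈ Z, ∀ y, G.Adj x y → y ∈ Z ∨ y ∈ S) :
    Even Z.ncard := by
  obtain ⟨a, b, c, d, f, hS, hnd, hab, hcd⟩ := h.matching
  obtain ⟨m, hm, hmf, hmS⟩ := h.exists_mate hG (by simp [hS]) hnd hab hcd
  refine hm.even fun x hx => (hcl x hx _ (hm.1 x)).resolve_right fun hmx => ?_
  by_cases h6 : m x = f
  · rw [← h6, hm.2] at hmf
    exact (hZS x hx).2 hmf
  · have := hmS _ hmx h6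
    rw [hm.2] at this
    exact (hZS x hx).1 this

lemma isFull (h : TypeTwoCut G u v S A B W) (hG : KExt G 2) (hclaw : ClawFree G) {a b c d f : V}
    (hS : ∀ x, x ∈ S ↔ x = a ∨ x = b ∨ x = c ∨ x = d ∨ x = f) (hnd : [a, b, c, d, f].Nodup)
    (hab : G.Adj a b) (hcd : G.Adj c d) : IsFull G u v S A B W f := by
  obtain ⟨m, hm, hmf, hmS⟩ := h.exists_mate hG hS hnd hab hcd
  have hfS : f ∈ S := by grind
  have hnd' : [a, b, c, d].Nodup := by simp at hnd ⊢; grind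
  have hS4 : ∀ x, x ∈ ({a, b, c, d} : Set V) ↔ x ∈ S ∧ x ≠ f := by
    intro x
    simp at hnd ⊢
    grind
  have hcard : ({a, b, c, d} : Set V).ncard = 4 := by
    simp at hnd
    rw [Set.ncard_insert_of_notMem (by simp; grind), Set.ncard_insert_of_notMem (by simp; grind),
      Set.ncard_pair (by grind)]
  have hfail : ¬ Admissible G 2 u v {a, b, c, d} := fun hadm => by
    have := h.le_ncard _ hadm
    omega
  have hu := h.mem_left
  have hv := h.mem_right
  have hD := h.disj
  have hA : ∃ x ∈ A, G.Adj f x := by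
    by_contra! hc
    refine hfail (hG.admissible_of_odd_closed hnd' hab hcd (X := A) (by grind) (by grind) hu
      (by grind) (by grind) h.odd_left fun x hx y hxy => ?_)
    have := h.closed_left x hx y hxy
    have := hc x hx
    have := hxy.symm
    grind
  have hB : ∃ x ∈ B, G.Adj f x := by
    by_contra! hc
    refine hfail (hG.admissible_of_odd_closed hnd' hab hcd (X := (B ∪ {a, b, c, d})ᶜ)
      (by grind) (by grind) (by simp at hS4 ⊢; grind) (by grind) (by grind) ?_
      fun x hx y hxy => ?_)
    · have h1 : Even (Set.univ : Set V).ncard := hm.even fun x _ => Set.mem_univ _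
      have h2 := Set.ncard_add_ncard_compl (B ∪ {a, b, c, d})
      have h3 : (B ∪ {a, b, c, d}).ncard = B.ncard + 4 := by
        rw [Set.ncard_union_eq (by rw [Set.disjoint_left]; grind), hcard]
      have h4 := h.odd_right
      rw [Set.ncard_univ] at h1
      grind
    · by_cases hy : y ∈ B
      · have h1 := h.closed_right y hy x hxy.symm
        have := hc y hy
        rw [Set.mem_compl_iff, Set.mem_union] at hx
        grind
      · by_cases hy' : y ∈ ({a, b, c, d} : Set V)
        · exact .inr (.inl hy')
        · exact .inl (by rw [Set.mem_compl_iff, Set.mem_union]; tauto)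
  have hW : ∃ x ∈ W, G.Adj f x := ⟨m f, hmf, hm.1 f⟩
  obtain ⟨w, hw, hfw⟩ := hW
  have key : ∀ x ∈ A, ∀ y ∈ B, G.Adj f x → G.Adj f y → x = u ∧ y = v := by
    intro x hx y hy hfx hfy
    by_contra hne
    refine hclaw f x y w hfx hfy hfw (by grind) (by grind) (by grind) (fun hxy => ?_)
      (fun hxw => ?_) (fun hyw => ?_)
    · have := h.closed_left x hx y hxy
      grind
    · have := h.closed_left x hx w hxw
      grind
    · have := h.closed_right y hy w hyw
      grind
  obtain ⟨x, hx, hfx⟩ := hA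
  obtain ⟨y, hy, hfy⟩ := hB
  obtain ⟨rfl, rfl⟩ := key x hx y hy hfx hfy
  refine ⟨hfx, hfy, ⟨w, hw, hfw⟩, fun p hp hfp => (key p hp y hy hfp hfy).1,
    fun p hp hfp => (key x hx p hp hfx hfp).2, fun z hfz => ?_⟩
  by_contra! hc
  refine hclaw f x w z hfx hfw hfz (by grind) (by grind) (by grind) (fun hxw => ?_)
    (fun hxz => ?_) (fun hwz => ?_)
  · have := h.closed_left x hx w hxw
    grind
  · have h1 := h.closed_left x hx z hxz
    have h2 : z ∈ A := by grind
    have := (key z h2 y hy hfz hfy).1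
    grind
  · have := h.closed_third w hw z hwz
    grind

/-- If the component of `u` is not a singleton, then some common neighbour `s` of `u` and `v` has
no further neighbour in the neighbourhood of `u`, and the rest of that neighbourhood is a clique. -/
lemma exists_pendant (h : TypeTwoCut G u v S A B W) (hG : KExt G 2) (hclaw : ClawFree G)
    (hd : SixNbrs G) {x : V} (hx : x ∈ A) (hxu : x ≠ u) :
    ∃ s, G.Adj u s ∧ G.Adj s v ∧ (∀ q, G.Adj u q → q ≠ v → ¬ G.Adj s q) ∧
      ∀ q q', G.Adj u q → G.Adj u q' → q ≠ v → q' ≠ v → q ≠ s → q' ≠ s → q ≠ q' →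
        G.Adj q q' := by
  obtain ⟨a, b, c, d, f, hSeq, hnd, hab, hcd⟩ := h.matching
  have hS : ∀ x, x ∈ S ↔ x = a ∨ x = b ∨ x = c ∨ x = d ∨ x = f := by simp [hSeq]
  have hu := h.mem_left
  have hv := h.mem_right
  have hD := h.disj
  have symm : ∀ {x y : V}, G.Adj x y → G.Adj y x := fun h => h.symm
  have hf := h.isFull hG hclaw hS hnd hab hcd
  have hiso : ∀ p ∈ S, ¬ G.Adj f p := by
    obtain ⟨k, hk, hku, huk⟩ : ∃ k ∈ A, k ≠ u ∧ G.Adj u k := by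
      by_contra! hc
      have h1 := h.conn_left {u} (by simpa using hu) ⟨u, rfl⟩ (by
        intro p hp q hq hpq
        rw [Set.mem_singleton_iff] at hp ⊢
        subst hp
        by_contra hq'
        exact hc q hq hq' hpq)
      rw [← h1] at hx
      exact hxu hx
    have aux : ∀ {a b c d : V}, (∀ x, x ∈ S ↔ x = a ∨ x = b ∨ x = c ∨ x = d ∨ x = f) →
        [a, b, c, d, f].Nodup → G.Adj a b → G.Adj c d → ¬ G.Adj f a := by
      intro a b c d hS hnd hab hcd hfa
      have hb := h.isFull hG hclaw (a := f) (b := a) (c := c) (d := d) (f := b)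
        (by grind) (by simp at hnd ⊢; grind) hfa hcd
      have hfb : G.Adj f b := by
        by_contra hfb
        refine hclaw u f b k hf.adj_left.symm hb.adj_left.symm huk (by simp at hnd; grind)
          (by grind) (by grind) hfb (fun hfk => ?_) (fun hbk => ?_)
        · exact hku (hf.eq_left k hk hfk)
        · exact hku (hb.eq_left k hk hbk)
      have ha := h.isFull hG hclaw (a := f) (b := b) (c := c) (d := d) (f := a)
        (by grind) (by simp at hnd ⊢; grind) hfb hcd
      refine hG.false_of_three_cut hd hcd (c := u) (by grind) (by grind) (X := A \ {u})
        (by grind) (by grind) (by grind) ⟨k, hk, hku⟩ (fun p hp q hpq => ?_) (y := v)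
        (by grind) (by grind) (by grind) (by grind)
      have h1 := h.closed_left p hp.1 q hpq
      have h2 := hf.eq_left p hp.1
      have h3 := ha.eq_left p hp.1
      have h4 := hb.eq_left p hp.1
      have h5 := symm hpq
      have h6 : p ≠ u := hp.2
      have h7 := hS q
      simp only [Set.mem_sdiff, Set.mem_singleton_iff]
      grind
    intro p hp
    rcases (hS p).1 hp with rfl | rfl | rfl | rfl | rfl
    · exact aux hS hnd hab hcd
    · exact aux (a := p) (b := a) (c := c) (d := d) (by grind) (by simp at hnd ⊢; grind)
        hab.symm hcd
    · exact aux (a := p) (b := d) (c := a) (d := b) (by grind) (by simp at hnd ⊢; grind)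
        hcd hab
    · exact aux (a := p) (b := c) (c := a) (d := b) (by grind) (by simp at hnd ⊢; grind)
        hcd.symm hab
    · exact G.irrefl
  have hpend : ∀ q, G.Adj u q → q ≠ v → ¬ G.Adj f q := by
    intro q huq hqv hfq
    have h1 := hf.nbr q hfq
    have h2 := hiso q
    have h3 := h.closed_left u hu q huq
    have h4 := huq.ne
    grind
  refine ⟨f, hf.adj_left.symm, hf.adj_right, hpend, ?_⟩
  intro q q' hq hq' hqv hqv' hqf hqf' hne
  by_contra hqq
  exact hclaw u f q q' hf.adj_left.symm hq hq' (Ne.symm hqf) (Ne.symm hqf') hne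
    (hpend q hq hqv) (hpend q' hq' hqv') hqq

lemma adj_iff_of_singleton (h : TypeTwoCut G u v S A B W) (hd : SixNbrs G)
    (hA : ∀ x ∈ A, x = u) (z : V) : G.Adj u z ↔ z ∈ S ∨ z = v := by
  obtain ⟨a, b, c, d, f, hSeq, hnd, hab, hcd⟩ := h.matching
  have hS : ∀ x, x ∈ S ↔ x = a ∨ x = b ∨ x = c ∨ x = d ∨ x = f := by simp [hSeq]
  have hsub : ∀ z, G.Adj u z → z ∈ S ∨ z = v := by
    intro z hz
    have h1 := h.closed_left u h.mem_left z hz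
    have h2 := hz.ne
    grind
  refine ⟨hsub z, ?_⟩
  rintro (hz | rfl)
  · by_contra hc
    have aux : ∀ a b c d : V, (∀ x, x ∈ S ↔ x = a ∨ x = b ∨ x = c ∨ x = d ∨ x = z) → False := by
      intro a b c d hS
      obtain ⟨y, huy, hy⟩ := hd u [a, b, c, d, v] (by simp)
      simp at hy
      have := hsub y huy
      grind
    rcases (hS z).1 hz with rfl | rfl | rfl | rfl | rfl
    · exact aux b c d f (by grind)
    · exact aux a c d f (by grind)
    · exact aux a b d f (by grind)
    · exact aux a b c f (by grind)
    · exact aux a b c d (by grind)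
  · exact h.adj

end TypeTwoCut

lemma exists_other_three {V : Type*} [Finite V] {S : Set V} {a b c d f x y : V}
    (hS : S = {a, b, c, d, f}) (hnd : [a, b, c, d, f].Nodup) (hx : x ∈ S) (hy : y ∈ S)
    (hxy : x ≠ y) :
    ∃ p q r, (∀ z, z ∈ S ↔ z = x ∨ z = y ∨ z = p ∨ z = q ∨ z = r) ∧ [x, y, p, q, r].Nodup := by
  have h5 : S.ncard = 5 := by
    simp at hnd
    rw [hS, Set.ncard_insert_of_notMem (by simp; grind),
      Set.ncard_insert_of_notMem (by simp; grind), Set.ncard_insert_of_notMem (by simp; grind),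
      Set.ncard_pair (by grind)]
  have h3 : (S \ {x, y}).ncard = 3 := by
    rw [Set.ncard_sdiff (by intro z hz; simp at hz; grind), h5, Set.ncard_pair hxy]
  obtain ⟨p, q, r, hpq, hpr, hqr, hs⟩ := Set.ncard_eq_three.1 h3
  have key : ∀ z, (z ∈ S ∧ z ≠ x ∧ z ≠ y) ↔ (z = p ∨ z = q ∨ z = r) := fun z => by
    simpa using Set.ext_iff.1 hs z
  exact ⟨p, q, r, by grind, by simp; grind⟩

namespace TypeTwoCut

variable {V : Type*} [Fintype V] {G : SimpleGraph V} {u : V}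

lemma false_of_singleton_of_pendant {v v' s : V} {S A B W : Set V}
    (h : TypeTwoCut G u v S A B W) (hG : KExt G 2) (hclaw : ClawFree G) (hd : SixNbrs G)
    (hA : ∀ x ∈ A, x = u) (hv' : G.Adj u v') (hs : G.Adj u s) (hsv : G.Adj s v')
    (hpend : ∀ q, G.Adj u q → q ≠ v' → ¬ G.Adj s q)
    (hclq : ∀ q q', G.Adj u q → G.Adj u q' → q ≠ v' → q' ≠ v' → q ≠ s → q' ≠ s → q ≠ q' →
        G.Adj q q') (hvv : v ≠ v') (hvs : v ≠ s) : False := by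
  have hiff := h.adj_iff_of_singleton hd hA
  obtain ⟨a, b, c, d, f, hSeq, hnd, -, -⟩ := h.matching
  obtain ⟨p, q, r, hS, hnd⟩ := exists_other_three hSeq hnd
    (((hiff v').1 hv').resolve_right hvv.symm) (((hiff s).1 hs).resolve_right hvs.symm) hsv.ne'
  have hu := h.mem_left
  have hv := h.mem_right
  have hD := h.disj
  have symm : ∀ {x y : V}, G.Adj x y → G.Adj y x := fun h => h.symm
  have hnd' := hnd
  simp at hnd'
  have hp := h.isFull hG hclaw (a := v') (b := s) (c := q) (d := r) (f := p) (by grind)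
    (by simp; grind) hsv.symm (hclq q r (by grind) (by grind) (by grind) (by grind) (by grind)
      (by grind) (by grind))
  have hq := h.isFull hG hclaw (a := v') (b := s) (c := p) (d := r) (f := q) (by grind)
    (by simp; grind) hsv.symm (hclq p r (by grind) (by grind) (by grind) (by grind) (by grind)
      (by grind) (by grind))
  have hr := h.isFull hG hclaw (a := v') (b := s) (c := p) (d := q) (f := r) (by grind)
    (by simp; grind) hsv.symm (hclq p q (by grind) (by grind) (by grind) (by grind) (by grind)
      (by grind) (by grind))
  by_cases hB : ∃ x ∈ B, x ≠ v
  · obtain ⟨x, hx, hxv⟩ := hB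
    refine hG.false_of_three_cut hd hsv.symm (c := v) hvv hvs (X := B \ {v}) (by grind)
      (by grind) (by grind) ⟨x, hx, hxv⟩ (fun y hy z hyz => ?_) (y := u)
      (by grind) hv'.ne hs.ne h.adj.ne
    have h1 := h.closed_right y hy.1 z hyz
    have h2 := hp.eq_right y hy.1
    have h3 := hq.eq_right y hy.1
    have h4 := hr.eq_right y hy.1
    have h5 := symm hyz
    have h6 : y ≠ v := hy.2
    have h7 := hS z
    simp only [Set.mem_sdiff, Set.mem_singleton_iff]
    grind
  · push Not at hB
    obtain ⟨y, hvy, hy⟩ := hd v [u, v', p, q, r] (by simp)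
    simp at hy
    have h1 := h.closed_right v hv y hvy
    have h2 := hS y
    have h3 := hvy.ne
    have h4 : y = s := by grind
    subst h4
    exact hpend v h.adj hvv hvy.symm

lemma third_eq {v₁ v₂ : V} {S₁ A₁ B₁ W₁ S₂ A₂ B₂ W₂ : Set V}
    (h₁ : TypeTwoCut G u v₁ S₁ A₁ B₁ W₁) (h₂ : TypeTwoCut G u v₂ S₂ A₂ B₂ W₂) (hG : KExt G 2)
    (hclaw : ClawFree G) (hd : SixNbrs G) (hA₁ : ∀ x ∈ A₁, x = u) (hA₂ : ∀ x ∈ A₂, x = u) :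
    W₁ = W₂ := by
  have hi₁ := h₁.adj_iff_of_singleton hd hA₁
  have hi₂ := h₂.adj_iff_of_singleton hd hA₂
  have hu₁ := h₁.mem_left
  have hu₂ := h₂.mem_left
  have hv₁ := h₁.mem_right
  have hv₂ := h₂.mem_right
  have hD₁ := h₁.disj
  have hD₂ := h₂.disj
  have hn₁ : ∀ x ∈ W₁, ¬ G.Adj u x := by grind
  have hn₂ : ∀ x ∈ W₂, ¬ G.Adj u x := by grind
  have hw₂ : ∀ x ∈ W₂, ∀ y, G.Adj x y → y ∈ W₂ ∨ G.Adj u y := fun x hx y hxy => by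
    have := h₂.closed_third x hx y hxy
    grind
  have hw₁ : ∀ x ∈ W₁, ∀ y, G.Adj x y → y ∈ W₁ ∨ G.Adj u y := fun x hx y hxy => by
    have := h₁.closed_third x hx y hxy
    grind
  by_cases hint : (W₁ ∩ W₂).Nonempty
  · rw [← h₁.conn_third (W₁ ∩ W₂) Set.inter_subset_left hint (fun x hx y hy hxy =>
      ⟨hy, (hw₂ x hx.2 y hxy).resolve_right (hn₁ y hy)⟩)]
    exact h₂.conn_third (W₁ ∩ W₂) Set.inter_subset_right hint (fun x hx y hy hxy =>
      ⟨(hw₁ x hx.1 y hxy).resolve_right (hn₂ y hy), hy⟩)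
  exfalso
  have hdis : ∀ x ∈ W₂, x ∉ W₁ := fun x hx hx' => hint ⟨x, hx', hx⟩
  have hodd₂ := h₂.odd_third
  by_cases hvW : ∃ y ∈ W₂, G.Adj v₁ y
  · obtain ⟨y, hy, hvy⟩ := hvW
    have hcl : ∀ x ∈ B₁, ∀ z, G.Adj x z → z ∈ B₁ ∨ G.Adj u z ∨ z = u := fun x hx z hxz => by
      have := h₁.closed_right x hx z hxz
      grind
    have huW : u ∉ W₂ := (hD₂ u).1 hu₂ |>.2.1
    have hWB : W₂ ∩ B₁ = W₂ := h₂.conn_third _ Set.inter_subset_left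
      ⟨y, hy, by have := hcl v₁ hv₁ y hvy; grind⟩ (fun x hx z hz hxz =>
        ⟨hz, by have := hcl x hx.2 z hxz; grind⟩)
    have hsub : W₂ ⊆ B₁ := hWB ▸ Set.inter_subset_right
    have hvW₂ : v₁ ∉ W₂ := fun h => hn₂ _ h h₁.adj
    have hnuB : ∀ x ∈ B₁, x ≠ v₁ → ¬ G.Adj u x := by grind
    have hnWZ : ∀ x ∈ B₁, x ∉ W₂ → x ≠ v₁ → ∀ z ∈ W₂, ¬ G.Adj z x := by grind
    have heven : Even (B₁ \ insert v₁ W₂).ncard := by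
      refine h₁.even_of_closed hG (by grind) fun x hx z hxz => ?_
      have hxB : x ∈ B₁ := hx.1
      have hxv : x ≠ v₁ := fun h => hx.2 (by simp [h])
      have hxW : x ∉ W₂ := fun h => hx.2 (by simp [h])
      have h3 : z ∉ W₂ := fun hz => hnWZ x hxB hxW hxv z hz hxz.symm
      have h4 : z ≠ v₁ := by
        rintro rfl
        exact hclaw z u y x h₁.adj.symm hvy hxz.symm (by grind) (by grind) (by grind)
          (hn₂ y hy) (hnuB x hxB hxv) (hnWZ x hxB hxW hxv y hy)
      have := h₁.closed_right x hxB z hxz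
      simp only [Set.mem_sdiff, Set.mem_insert_iff]
      grind
    have hcard := Set.ncard_sdiff_add_ncard_of_subset (s := insert v₁ W₂) (t := B₁)
      (Set.insert_subset hv₁ hsub)
    rw [Set.ncard_insert_of_notMem hvW₂] at hcard
    have := h₁.odd_right
    grind
  · push Not at hvW
    have : Even W₂.ncard := h₁.even_of_closed hG (by grind) fun x hx z hxz => by
      have h1 := hw₂ x hx z hxz
      have h2 := hvW x hx
      have h3 := hxz.symm
      grind
    grind

lemma false_of_three_singletons {v₁ v₂ v₃ : V}
    {S₁ A₁ B₁ W₁ S₂ A₂ B₂ W₂ S₃ A₃ B₃ W₃ : Set V}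
    (h₁ : TypeTwoCut G u v₁ S₁ A₁ B₁ W₁) (h₂ : TypeTwoCut G u v₂ S₂ A₂ B₂ W₂)
    (h₃ : TypeTwoCut G u v₃ S₃ A₃ B₃ W₃) (hG : KExt G 2)
    (hclaw : ClawFree G) (hd : SixNbrs G) (hA₁ : ∀ x ∈ A₁, x = u) (hA₂ : ∀ x ∈ A₂, x = u)
    (hA₃ : ∀ x ∈ A₃, x = u) (h12 : v₁ ≠ v₂) (h13 : v₁ ≠ v₃) (h23 : v₂ ≠ v₃) : False := by
  obtain rfl := h₁.third_eq h₂ hG hclaw hd hA₁ hA₂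
  obtain rfl := h₁.third_eq h₃ hG hclaw hd hA₁ hA₃
  have hi₁ := h₁.adj_iff_of_singleton hd hA₁
  have hi₂ := h₂.adj_iff_of_singleton hd hA₂
  have symm : ∀ {x y : V}, G.Adj x y → G.Adj y x := fun h => h.symm
  have hW₂ : ¬ ∃ w ∈ W₁, G.Adj v₂ w := by
    rintro ⟨w, hw, hvw⟩
    have h1 := h₂.closed_third w hw v₂ hvw.symm
    have h2 := (h₂.disj v₂).2.1 h₂.mem_right
    grind
  have hW₃ : ¬ ∃ w ∈ W₁, G.Adj v₃ w := by
    rintro ⟨w, hw, hvw⟩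
    have h1 := h₃.closed_third w hw v₃ hvw.symm
    have h2 := (h₃.disj v₃).2.1 h₃.mem_right
    grind
  have hv₁S : v₁ ∉ S₁ := ((h₁.disj v₁).2.1 h₁.mem_right).2
  have hv₂S : v₂ ∉ S₂ := ((h₂.disj v₂).2.1 h₂.mem_right).2
  have hv₂S₁ : v₂ ∈ S₁ := ((hi₁ v₂).1 h₂.adj).resolve_right h12.symm
  have hv₃S₁ : v₃ ∈ S₁ := ((hi₁ v₃).1 h₃.adj).resolve_right h13.symm
  have hS₂ : ∀ x, x ∈ S₂ ↔ (x ∈ S₁ ∨ x = v₁) ∧ x ≠ v₂ := by grind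
  have main : ∀ {b c d f : V}, (∀ x, x ∈ S₁ ↔ x = v₂ ∨ x = b ∨ x = c ∨ x = d ∨ x = f) →
      [v₂, b, c, d, f].Nodup → G.Adj v₂ b → G.Adj c d → (v₃ = b ∨ v₃ = c) → False := by
    intro b c d f hS hnd hab hcd hb
    have hnd' := hnd
    simp at hnd'
    have hf := h₁.isFull hG hclaw hS hnd hab hcd
    have hnadj : ∀ x y, (x = c ∨ x = b) → x ≠ v₃ → y = d → ¬ G.Adj x y := by
      intro x y hx hx' rfl hxy
      refine hW₃ (h₂.isFull hG hclaw (a := f) (b := v₁) (c := x) (d := y) (f := v₃)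
        (fun z => ?_) ?_ hf.adj_right hxy).adj_third
      · have := hS z
        have := hS₂ z
        grind
      · have := hS v₁
        simp
        grind
    rcases hb with rfl | rfl
    · exact hnadj c d (.inl rfl) (by grind) rfl hcd
    · have hfb : ¬ G.Adj f b := fun hfb =>
        hW₂ (h₁.isFull hG hclaw (a := f) (b := b) (c := v₃) (d := d) (f := v₂) (by grind)
          (by simp; grind) hfb hcd).adj_third
      have hfd : ¬ G.Adj f d := fun hfd =>
        hW₃ (h₁.isFull hG hclaw (a := f) (b := d) (c := v₂) (d := b) (f := v₃) (by grind)
          (by simp; grind) hfd hab).adj_third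
      exact hclaw u f b d (by grind) (by grind) (by grind) (by grind) (by grind) (by grind)
        hfb hfd (hnadj b d (.inr rfl) (by grind) rfl)
  have main' : ∀ {b c d f : V}, (∀ x, x ∈ S₁ ↔ x = v₂ ∨ x = b ∨ x = c ∨ x = d ∨ x = f) →
      [v₂, b, c, d, f].Nodup → G.Adj v₂ b → G.Adj c d → False := by
    intro b c d f hS hnd hab hcd
    rcases (hS v₃).1 hv₃S₁ with h | h | h | h | h
    · exact h23 h.symm
    · exact main hS hnd hab hcd (.inl h)
    · exact main hS hnd hab hcd (.inr h)
    · exact main (b := b) (c := d) (d := c) (f := f) (by grind) (by simp at hnd ⊢; grind) hab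
        hcd.symm (.inr h)
    · exact hW₃ (h ▸ (h₁.isFull hG hclaw hS hnd hab hcd).adj_third)
  obtain ⟨a, b, c, d, f, hSeq, hnd, hab, hcd⟩ := h₁.matching
  have hS : ∀ x, x ∈ S₁ ↔ x = a ∨ x = b ∨ x = c ∨ x = d ∨ x = f := by simp [hSeq]
  rcases (hS v₂).1 hv₂S₁ with rfl | rfl | rfl | rfl | rfl
  · exact main' hS hnd hab hcd
  · exact main' (b := a) (c := c) (d := d) (f := f) (by grind) (by simp at hnd ⊢; grind)
      hab.symm hcd
  · exact main' (b := d) (c := a) (d := b) (f := f) (by grind) (by simp at hnd ⊢; grind) hcd hab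
  · exact main' (b := c) (c := a) (d := b) (f := f) (by grind) (by simp at hnd ⊢; grind)
      hcd.symm hab
  · exact hW₂ (h₁.isFull hG hclaw hS hnd hab hcd).adj_third

/-- A type 2 edge `uv` at which the component of `u` is not a singleton leaves room for only one
further type 2 edge at `u`. -/
lemma false_of_nonsingleton {v₁ v₂ v₃ x : V} {S₁ A₁ B₁ W₁ S₂ A₂ B₂ W₂ S₃ A₃ B₃ W₃ : Set V}
    (h₁ : TypeTwoCut G u v₁ S₁ A₁ B₁ W₁) (h₂ : TypeTwoCut G u v₂ S₂ A₂ B₂ W₂)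
    (h₃ : TypeTwoCut G u v₃ S₃ A₃ B₃ W₃) (hG : KExt G 2)
    (hclaw : ClawFree G) (hd : SixNbrs G) (hx : x ∈ A₁) (hxu : x ≠ u)
    (h12 : v₁ ≠ v₂) (h13 : v₁ ≠ v₃) (h23 : v₂ ≠ v₃) : False := by
  obtain ⟨s, hus, hsv, hpend, hclq⟩ := h₁.exists_pendant hG hclaw hd hx hxu
  have aux : ∀ {v S A B W}, TypeTwoCut G u v S A B W → v ≠ v₁ → v ≠ s → False := by
    intro v S A B W h hv hvs
    by_cases hA : ∀ x ∈ A, x = u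
    · exact h.false_of_singleton_of_pendant hG hclaw hd hA h₁.adj hus hsv hpend hclq hv hvs
    · push Not at hA
      obtain ⟨y, hy, hyu⟩ := hA
      obtain ⟨t, hut, htv, hpend', -⟩ := h.exists_pendant hG hclaw hd hy hyu
      by_cases hts : t = s
      · subst hts
        exact hpend v h.adj hv htv
      by_cases htv₁ : t = v₁
      · subst htv₁
        exact hpend' s hus (Ne.symm hvs) hsv.symm
      obtain ⟨q, huq, hq⟩ := hd u [v₁, s, t, v] (by simp)
      simp at hq
      exact hpend' q huq (by grind) (hclq t q hut huq htv₁ (by grind) hts (by grind) (by grind))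
  by_cases h2s : v₂ = s
  · exact aux h₃ h13.symm (by grind)
  · exact aux h₂ h12.symm h2s

end TypeTwoCut

theorem stmt17 {V : Type*} [Fintype V] (G : SimpleGraph V) [DecidableRel G.Adj]
    (hclaw : ClawFree G) (hmin : MinimalKExt G 2) (hdelta : 6 ≤ G.minDegree)
    (u : V) :
    Set.ncard {v : V | G.Adj u v ∧ EdgeType G u v 5} ≤ 2 := by
  have hd := sixNbrs_of_minDegree hdelta
  have hG := hmin.1
  by_contra! hc
  obtain ⟨v₁, v₂, v₃, ⟨hu₁, ht₁⟩, ⟨hu₂, ht₂⟩, ⟨hu₃, ht₃⟩, h12, h13, h23⟩ :=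
    (Set.two_lt_ncard_iff (Set.toFinite _)).1 hc
  obtain ⟨S₁, A₁, B₁, W₁, h₁⟩ := ht₁.exists_cut hu₁
  obtain ⟨S₂, A₂, B₂, W₂, h₂⟩ := ht₂.exists_cut hu₂
  obtain ⟨S₃, A₃, B₃, W₃, h₃⟩ := ht₃.exists_cut hu₃
  by_cases hA₁ : ∀ x ∈ A₁, x = u
  · by_cases hA₂ : ∀ x ∈ A₂, x = u
    · by_cases hA₃ : ∀ x ∈ A₃, x = u
      · exact h₁.false_of_three_singletons h₂ h₃ hG hclaw hd hA₁ hA₂ hA₃ h12 h13 h23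
      · push Not at hA₃
        obtain ⟨x, hx, hxu⟩ := hA₃
        exact h₃.false_of_nonsingleton h₁ h₂ hG hclaw hd hx hxu h13.symm h23.symm h12
    · push Not at hA₂
      obtain ⟨x, hx, hxu⟩ := hA₂
      exact h₂.false_of_nonsingleton h₁ h₃ hG hclaw hd hx hxu h12.symm h23 h13
  · push Not at hA₁
    obtain ⟨x, hx, hxu⟩ := hA₁
    exact h₁.false_of_nonsingleton h₂ h₃ hG hclaw hd hx hxu h12 h13 h23
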